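/- arXiv:2402.14368 — 12 statements merged into one kernel-verified Lean document; each statement's English description precedes it below -/
import Mathlib

section
/- Let μ ∈ ℝ, σ > 0, and let g₁, g₂ : ℝ → ℝ satisfy conditions (C1)–(C4). Then the function f(x) = μ + σ·x·(g₁(x) + g₂(x) + 1) is strictly increasing on ℝ. (Proposition 1) -/
open Filter Real Set

/-- Proposition 1: under conditions (C1)–(C4), the transformation
`f(x) = μ + σ·x·(g₁(x) + g₂(x) + 1)` is strictly increasing on ℝ. -/
theorem f_strictMono (μ σ : ℝ) (hσ : 0 < σ) (g₁ g₂ : ℝ → ℝ)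
    (hC1 : Continuous g₁ ∧ Continuous g₂ ∧
      ∀ x : ℝ, x ≠ 0 → DifferentiableAt ℝ g₁ x ∧ DifferentiableAt ℝ g₂ x)
    (hC2 : Monotone g₁ ∧ Antitone g₂)
    (hC3 : Tendsto g₁ atBot (nhds 0) ∧ Tendsto g₂ atTop (nhds 0))
    (hC4 : ∀ x : ℝ, x ≠ 0 →
      g₁ x + x * deriv g₁ x > -(1/2) ∧ g₂ x + x * deriv g₂ x > -(1/2)) :
    StrictMono (fun x : ℝ => μ + σ * x * (g₁ x + g₂ x + 1)) := by
  obtain ⟨hg₁, hg₂, hdiff⟩ := hC1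
  have hcont : Continuous fun x : ℝ => μ + σ * x * (g₁ x + g₂ x + 1) := by fun_prop
  have hderiv : ∀ x : ℝ, x ≠ 0 → 0 < deriv (fun x : ℝ => μ + σ * x * (g₁ x + g₂ x + 1)) x := by
    intro x hx
    have hf := (((hasDerivAt_id' x).const_mul σ).mul
      (((hdiff x hx).1.hasDerivAt.add (hdiff x hx).2.hasDerivAt).add_const 1)).const_add μ
    have hpos : 0 < σ * ((g₁ x + x * deriv g₁ x) + (g₂ x + x * deriv g₂ x) + 1) :=
      mul_pos hσ (by linarith [(hC4 x hx).1, (hC4 x hx).2])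
    refine hpos.trans_eq (Eq.trans ?_ hf.deriv.symm)
    simp only [Pi.add_apply]
    ring
  refine StrictMonoOn.Iic_union_Ici (a := 0) ?_ ?_
  · refine strictMonoOn_of_deriv_pos (convex_Iic 0) hcont.continuousOn fun x hx => hderiv x ?_
    rw [interior_Iic] at hx
    exact hx.ne
  · refine strictMonoOn_of_deriv_pos (convex_Ici 0) hcont.continuousOn fun x hx => hderiv x ?_
    rw [interior_Ici] at hx
    exact hx.ne'
end

section
/- Let X be a real random variable with continuous, strictly increasing cumulative distribution function F : ℝ → (0,1), with quantile function F⁻¹ : (0,1) → ℝ. Let μ ∈ ℝ, σ > 0, and let g₁, g₂ : ℝ → ℝ satisfy conditions (C1)–(C4), and set f(x) = μ + σ·x·(g₁(x) + g₂(x) + 1). Then f is a continuous, strictly increasing bijection from ℝ onto ℝ, the cumulative distribution function of the random variable Y = f(X) is F ∘ f⁻¹, and for every α ∈ (0,1) the α-quantile of Y equals f(F⁻¹(α)). (Proposition 2) -/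
open Filter Real Set MeasureTheory

/-- Multiplying the identity by `g₁ + g₂ + 1` keeps it strictly increasing when each
`x * gᵢ x` has derivative above `-1/2` away from the origin. -/
lemma strictMono_mul_add_add_one {g₁ g₂ : ℝ → ℝ} (hg₁ : Continuous g₁) (hg₂ : Continuous g₂)
    (hd : ∀ x : ℝ, x ≠ 0 → DifferentiableAt ℝ g₁ x ∧ DifferentiableAt ℝ g₂ x)
    (hlb : ∀ x : ℝ, x ≠ 0 →
      g₁ x + x * deriv g₁ x > -(1/2) ∧ g₂ x + x * deriv g₂ x > -(1/2)) :
    StrictMono (fun x : ℝ => x * (g₁ x + g₂ x + 1)) := by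
  have hcont : Continuous (fun x : ℝ => x * (g₁ x + g₂ x + 1)) := by fun_prop
  have hpos : ∀ x : ℝ, x ≠ 0 → 0 < deriv (fun x : ℝ => x * (g₁ x + g₂ x + 1)) x := by
    intro x hx
    have h := (hasDerivAt_id x).mul
      (((hd x hx).1.hasDerivAt.add (hd x hx).2.hasDerivAt).add_const 1)
    have h' : HasDerivAt (fun x : ℝ => x * (g₁ x + g₂ x + 1))
        (1 * (g₁ x + g₂ x + 1) + x * (deriv g₁ x + deriv g₂ x)) x := h
    rw [h'.deriv]
    linarith [(hlb x hx).1, (hlb x hx).2]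
  refine StrictMonoOn.Iic_union_Ici (a := 0) ?_ ?_
  · refine strictMonoOn_of_deriv_pos (convex_Iic 0) hcont.continuousOn fun x hx => ?_
    rw [interior_Iic] at hx
    exact hpos x (ne_of_lt hx)
  · refine strictMonoOn_of_deriv_pos (convex_Ici 0) hcont.continuousOn fun x hx => ?_
    rw [interior_Ici] at hx
    exact hpos x (ne_of_gt hx)

/-- Multiplying the identity by a continuous function bounded below by `1` is surjective. -/
lemma surjective_mul_of_one_le {k : ℝ → ℝ} (hk : Continuous k) (h1 : ∀ x, 1 ≤ k x) :
    Function.Surjective (fun x : ℝ => x * k x) := by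
  refine Continuous.surjective (by fun_prop) ?_ ?_
  · refine tendsto_atTop_mono' _ ?_ tendsto_id
    filter_upwards [eventually_ge_atTop 0] with x hx
    exact le_mul_of_one_le_right hx (h1 x)
  · refine tendsto_atBot_mono' _ ?_ tendsto_id
    filter_upwards [eventually_le_atBot 0] with x hx
    exact mul_le_of_one_le_right hx (h1 x)

/-- Proposition 2: if `X` has continuous, strictly increasing CDF `F` taking values in
`(0,1)` with quantile function `Finv`, and `f(x) = μ + σ·x·(g₁(x)+g₂(x)+1)` with
`(g₁, g₂)` satisfying (C1)–(C4), then `f` is a continuous strictly increasing bijection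
of ℝ onto ℝ, the CDF of `Y = f(X)` is `F ∘ f⁻¹`, and the `α`-quantile of `Y` is
`f(Finv α)` for every `α ∈ (0,1)`. -/
theorem cdf_and_quantile_of_transformed
    {Ω : Type*} [MeasurableSpace Ω] (P : Measure Ω) [IsProbabilityMeasure P]
    (X : Ω → ℝ) (hX : Measurable X)
    (F : ℝ → ℝ) (hFX : ∀ x : ℝ, F x = (P {ω | X ω ≤ x}).toReal)
    (hFcont : Continuous F) (hFmono : StrictMono F)
    (hFrange : ∀ x : ℝ, F x ∈ Set.Ioo (0 : ℝ) 1)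
    (Finv : ℝ → ℝ) (hFinv : ∀ α ∈ Set.Ioo (0 : ℝ) 1, F (Finv α) = α)
    (μ σ : ℝ) (hσ : 0 < σ) (g₁ g₂ : ℝ → ℝ)
    (hC1 : Continuous g₁ ∧ Continuous g₂ ∧
      ∀ x : ℝ, x ≠ 0 → DifferentiableAt ℝ g₁ x ∧ DifferentiableAt ℝ g₂ x)
    (hC2 : Monotone g₁ ∧ Antitone g₂)
    (hC3 : Tendsto g₁ atBot (nhds 0) ∧ Tendsto g₂ atTop (nhds 0))
    (hC4 : ∀ x : ℝ, x ≠ 0 →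
      g₁ x + x * deriv g₁ x > -(1/2) ∧ g₂ x + x * deriv g₂ x > -(1/2)) :
    Continuous (fun x : ℝ => μ + σ * x * (g₁ x + g₂ x + 1)) ∧
    StrictMono (fun x : ℝ => μ + σ * x * (g₁ x + g₂ x + 1)) ∧
    Function.Bijective (fun x : ℝ => μ + σ * x * (g₁ x + g₂ x + 1)) ∧
    (∀ x : ℝ, (P {ω | μ + σ * X ω * (g₁ (X ω) + g₂ (X ω) + 1) ≤ x}).toReal =
      F (Function.invFun (fun x : ℝ => μ + σ * x * (g₁ x + g₂ x + 1)) x)) ∧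
    (∀ α ∈ Set.Ioo (0 : ℝ) 1,
      (P {ω | μ + σ * X ω * (g₁ (X ω) + g₂ (X ω) + 1) ≤
        μ + σ * Finv α * (g₁ (Finv α) + g₂ (Finv α) + 1)}).toReal = α) := by
  obtain ⟨hg₁, hg₂, hd⟩ := hC1
  have hk : ∀ x, 1 ≤ g₁ x + g₂ x + 1 := fun x => by
    linarith [hC2.1.le_of_tendsto hC3.1 x, hC2.2.le_of_tendsto hC3.2 x]
  set f : ℝ → ℝ := fun x : ℝ => μ + σ * x * (g₁ x + g₂ x + 1) with hf
  have hmono : StrictMono f := by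
    intro a b hab
    have h : a * (g₁ a + g₂ a + 1) < b * (g₁ b + g₂ b + 1) :=
      strictMono_mul_add_add_one hg₁ hg₂ hd hC4 hab
    simp only [hf, mul_assoc]
    gcongr
  have hsurj : Function.Surjective f := by
    intro y
    obtain ⟨x, hx⟩ := surjective_mul_of_one_le (k := fun x => g₁ x + g₂ x + 1)
      (by fun_prop) hk ((y - μ) / σ)
    refine ⟨x, ?_⟩
    simp only [hf, mul_assoc]
    rw [show x * (g₁ x + g₂ x + 1) = (y - μ) / σ from hx]
    field_simp
    ring
  have hcdf : ∀ a : ℝ, (P {ω | f (X ω) ≤ f a}).toReal = F a := fun a => by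
    simp only [hmono.le_iff_le, hFX]
  refine ⟨by fun_prop, hmono, ⟨hmono.injective, hsurj⟩, fun x => ?_, fun α hα => ?_⟩
  · rw [← hcdf, Function.invFun_eq (hsurj x)]
  · exact (hcdf (Finv α)).trans (hFinv α hα)
end

section
/- Let F : ℝ → ℝ be a cumulative distribution function with F(x) < 1 for all x, let μ ∈ ℝ, σ > 0, and let g₁, g₂ : ℝ → ℝ satisfy conditions (C1)–(C4), so that f(x) = μ + σ·x·(g₁(x) + g₂(x) + 1) is a strictly increasing bijection of ℝ with inverse f⁻¹. Suppose there are constants ν > 0 and c > 0 with x^ν·(1 − F(x)) → c as x → +∞, and constants ν' > 0 and c' > 0 with x^{−ν'}·g₁(x) → c' as x → +∞. Then x^{ν/(1+ν')}·(1 − F(f⁻¹(x))) → c·(σ·c')^{ν/(1+ν')} as x → +∞; in particular, the distribution with cumulative function F ∘ f⁻¹ has right-tail index ν/(1+ν'). (Proposition 3, first part) -/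
open Filter Real Set

/-- A right inverse of `f` near `+∞` tends to `+∞` if `f` is bounded above on left half-lines. -/
theorem tendsto_invFun_atTop {f : ℝ → ℝ} (hf : ∀ᶠ x in atTop, ∃ y, f y = x)
    (hbdd : ∀ A, ∃ B, ∀ y ≤ A, f y ≤ B) :
    Tendsto (Function.invFun f) atTop atTop := by
  refine tendsto_atTop.2 fun A => ?_
  obtain ⟨B, hB⟩ := hbdd A
  filter_upwards [hf, eventually_gt_atTop B] with x hx hBx
  by_contra! hlt
  have h := hB _ hlt.le
  rw [Function.invFun_eq hx] at h
  linarith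

/-- If `f(y) ~ k y^p` and `1 - F(y) ~ c y^{-ν}` at `+∞`, then `f(y)^{ν/p} (1 - F(y))` converges. -/
theorem tendsto_rpow_mul_tail {f G : ℝ → ℝ} {p k ν c : ℝ} (hp : 0 < p) (hk : 0 < k)
    (hf : Tendsto (fun y : ℝ => y ^ (-p) * f y) atTop (nhds k))
    (hG : Tendsto (fun y : ℝ => y ^ ν * G y) atTop (nhds c)) :
    Tendsto (fun y : ℝ => f y ^ (ν / p) * G y) atTop (nhds (c * k ^ (ν / p))) := by
  have hpow := hf.rpow_const (p := ν / p) (Or.inl hk.ne')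
  refine (hG.mul hpow).congr' ?_
  filter_upwards [eventually_gt_atTop 0, hf.eventually_const_lt hk] with y hy hfy
  have hfy' : 0 < f y := pos_of_mul_pos_right hfy (rpow_pos_of_pos hy _).le
  rw [mul_rpow (rpow_pos_of_pos hy _).le hfy'.le, ← rpow_mul hy.le,
    show -p * (ν / p) = -ν by field_simp, rpow_neg hy.le]
  have := (rpow_pos_of_pos hy ν).ne'
  field_simp

/-- Asymptotics of the transformation: `μ + σ y (g₁(y) + g₂(y) + 1) ~ σ c' y^{1+ν'}`. -/
theorem tendsto_rpow_neg_mul_transform {g₁ g₂ : ℝ → ℝ} {ν' c' : ℝ} (μ σ : ℝ) (hν' : 0 < ν')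
    (hg₁ : Tendsto (fun x : ℝ => x ^ (-ν') * g₁ x) atTop (nhds c'))
    (hg₂ : Tendsto g₂ atTop (nhds 0)) :
    Tendsto (fun y : ℝ => y ^ (-(1 + ν')) * (μ + σ * y * (g₁ y + g₂ y + 1))) atTop
      (nhds (σ * c')) := by
  have h0 := tendsto_rpow_neg_atTop hν'
  have h1 := tendsto_rpow_neg_atTop (y := 1 + ν') (by linarith)
  have h := (h1.mul_const μ).add (((hg₁.add (h0.mul hg₂)).add h0).const_mul σ)
  simp only [zero_mul, add_zero, zero_add] at h
  refine h.congr' ?_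
  filter_upwards [eventually_gt_atTop 0] with y hy
  have : y ^ (-ν') = y ^ (-(1 + ν')) * y := by
    rw [← rpow_add_one hy.ne']
    ring_nf
  rw [this]
  ring

/-- Proposition 3, first part: if the base distribution `F` has right-tail index `ν`
(`x^ν·(1−F(x)) → c > 0`) and `g₁(x) ~ c'·x^{ν'}` at `+∞`, then the transformed
distribution `F ∘ f⁻¹` satisfies
`x^{ν/(1+ν')}·(1 − F(f⁻¹(x))) → c·(σc')^{ν/(1+ν')}`, i.e. it has right-tail index
`ν/(1+ν')`. -/
theorem tail_index_power_case (F : ℝ → ℝ) (hFmono : Monotone F)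
    (hFlt : ∀ x : ℝ, F x < 1)
    (μ σ : ℝ) (hσ : 0 < σ) (g₁ g₂ : ℝ → ℝ)
    (hC1 : Continuous g₁ ∧ Continuous g₂ ∧
      ∀ x : ℝ, x ≠ 0 → DifferentiableAt ℝ g₁ x ∧ DifferentiableAt ℝ g₂ x)
    (hC2 : Monotone g₁ ∧ Antitone g₂)
    (hC3 : Tendsto g₁ atBot (nhds 0) ∧ Tendsto g₂ atTop (nhds 0))
    (hC4 : ∀ x : ℝ, x ≠ 0 →
      g₁ x + x * deriv g₁ x > -(1/2) ∧ g₂ x + x * deriv g₂ x > -(1/2))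
    (ν c : ℝ) (hν : 0 < ν) (hc : 0 < c)
    (hFtail : Tendsto (fun x : ℝ => x ^ ν * (1 - F x)) atTop (nhds c))
    (ν' c' : ℝ) (hν' : 0 < ν') (hc' : 0 < c')
    (hg₁tail : Tendsto (fun x : ℝ => x ^ (-ν') * g₁ x) atTop (nhds c')) :
    Tendsto (fun x : ℝ => x ^ (ν / (1 + ν')) *
        (1 - F (Function.invFun (fun y : ℝ => μ + σ * y * (g₁ y + g₂ y + 1)) x)))
      atTop (nhds (c * (σ * c') ^ (ν / (1 + ν')))) := by
  obtain ⟨hg₁c, hg₂c, -⟩ := hC1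
  obtain ⟨hg₁m, hg₂m⟩ := hC2
  have hg₁0 : ∀ y, 0 ≤ g₁ y := hg₁m.le_of_tendsto hC3.1
  have hg₂0 : ∀ y, 0 ≤ g₂ y := hg₂m.le_of_tendsto hC3.2
  set f : ℝ → ℝ := fun y => μ + σ * y * (g₁ y + g₂ y + 1) with hf
  have hfc : Continuous f := by fun_prop
  have hasymp : Tendsto (fun y : ℝ => y ^ (-(1 + ν')) * f y) atTop (nhds (σ * c')) :=
    tendsto_rpow_neg_mul_transform μ σ hν' hg₁tail hC3.2
  have hle : ∀ y, 0 ≤ y → μ + σ * y ≤ f y := fun y hy => by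
    have := mul_nonneg (mul_nonneg hσ.le hy) (add_nonneg (hg₁0 y) (hg₂0 y))
    simp only [hf]
    linarith
  have hsurj : ∀ᶠ x in atTop, ∃ y, f y = x := by
    filter_upwards [eventually_ge_atTop μ] with x hx
    have hy : 0 ≤ (x - μ) / σ := div_nonneg (by linarith) hσ.le
    have hxf : x ≤ f ((x - μ) / σ) := by
      have := hle _ hy
      rw [mul_div_cancel₀ _ hσ.ne'] at this
      linarith
    obtain ⟨y, -, hyx⟩ := intermediate_value_Icc hy hfc.continuousOn
      (show x ∈ Icc (f 0) (f ((x - μ) / σ)) from ⟨by simpa [hf] using hx, hxf⟩)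
    exact ⟨y, hyx⟩
  have hbdd : ∀ A, ∃ B, ∀ y ≤ A, f y ≤ B := fun A => by
    obtain ⟨B, hB⟩ := (isCompact_Icc (a := (0 : ℝ)) (b := A)).bddAbove_image hfc.continuousOn
    refine ⟨max μ B, fun y hy => ?_⟩
    rcases le_total y 0 with hy0 | hy0
    · refine le_max_of_le_left ?_
      have := mul_nonpos_of_nonpos_of_nonneg (mul_nonpos_of_nonneg_of_nonpos hσ.le hy0)
        (by linarith [hg₁0 y, hg₂0 y] : 0 ≤ g₁ y + g₂ y + 1)
      simp only [hf]
      linarith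
    · exact le_max_of_le_right (hB ⟨y, ⟨hy0, hy⟩, rfl⟩)
  refine ((tendsto_rpow_mul_tail (by linarith) (mul_pos hσ hc') hasymp hFtail).comp
    (tendsto_invFun_atTop hsurj hbdd)).congr' ?_
  filter_upwards [hsurj] with x hx
  simp only [Function.comp_apply, Function.invFun_eq hx]
end

section
/- Let F : ℝ → ℝ be a cumulative distribution function with F(x) < 1 for all x, let μ ∈ ℝ, σ > 0, and let g₁, g₂ : ℝ → ℝ satisfy conditions (C1)–(C4), so that f(x) = μ + σ·x·(g₁(x) + g₂(x) + 1) is a strictly increasing bijection of ℝ with inverse f⁻¹. Suppose there are constants ν > 0, c > 0 with x^ν·(1 − F(x)) → c as x → +∞, and constants t > 0, ν' > 0, c' > 0 with e^{−t·x^{ν'}}·g₁(x) → c' as x → +∞. Then (log x)^{ν/ν'}·(1 − F(f⁻¹(x))) → c·t^{ν/ν'} as x → +∞. (Proposition 3, second part) -/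
open Filter Real Set

/-- If `f` is continuous and tends to `+∞` at `+∞`, then `Function.invFun f` is eventually a right
inverse of `f` at `+∞`. -/
lemma eventually_apply_invFun_of_tendsto_atTop {f : ℝ → ℝ} (hf : Continuous f)
    (htop : Tendsto f atTop atTop) : ∀ᶠ x in atTop, f (Function.invFun f x) = x := by
  filter_upwards [eventually_ge_atTop (f 0)] with x hx
  obtain ⟨b, hb, hb0⟩ := ((htop.eventually_ge_atTop x).and (eventually_ge_atTop 0)).exists
  obtain ⟨y, -, hy⟩ := intermediate_value_Icc hb0 hf.continuousOn ⟨hx, hb⟩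
  exact Function.invFun_eq ⟨y, hy⟩

/-- A function that is eventually a right inverse at `+∞` of a function bounded above on every
left half-line tends to `+∞`. -/
lemma tendsto_atTop_of_eventually_rightInverse {f k : ℝ → ℝ}
    (hbdd : ∀ A, ∃ B, ∀ y ≤ A, f y ≤ B) (hk : ∀ᶠ x in atTop, f (k x) = x) :
    Tendsto k atTop atTop := by
  refine tendsto_atTop.2 fun A => ?_
  obtain ⟨B, hB⟩ := hbdd A
  filter_upwards [hk, eventually_gt_atTop B] with x hx hBx
  by_contra! h
  linarith [hB _ h.le]

/-- The logarithm of `μ + σ y (g₁ y + g₂ y + 1)` is asymptotic to `t y ^ ν'` when `g₁` is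
asymptotic to `c' exp (t y ^ ν')` and `g₂` vanishes at `+∞`. -/
lemma tendsto_log_div_rpow {μ σ t ν' c' : ℝ} {g₁ g₂ : ℝ → ℝ} (hσ : 0 < σ) (ht : 0 < t)
    (hν' : 0 < ν') (hc' : 0 < c') (hg₂ : Tendsto g₂ atTop (nhds 0))
    (hg₁ : Tendsto (fun x : ℝ => Real.exp (-(t * x ^ ν')) * g₁ x) atTop (nhds c')) :
    Tendsto (fun y : ℝ => Real.log (μ + σ * y * (g₁ y + g₂ y + 1)) / y ^ ν') atTop (nhds t) := by
  have hpow : Tendsto (fun y : ℝ => y ^ ν') atTop atTop := tendsto_rpow_atTop hν'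
  have hexp : Tendsto (fun y : ℝ => Real.exp (-(t * y ^ ν'))) atTop (nhds 0) :=
    tendsto_exp_neg_atTop_nhds_zero.comp (hpow.const_mul_atTop ht)
  set h : ℝ → ℝ := fun y => Real.exp (-(t * y ^ ν')) * (μ / y) +
    σ * (Real.exp (-(t * y ^ ν')) * g₁ y + Real.exp (-(t * y ^ ν')) * (g₂ y + 1)) with hdef
  have hh : Tendsto h atTop (nhds (σ * c')) := by
    have h₁ := hexp.mul (tendsto_const_nhds (x := μ) |>.div_atTop tendsto_id)
    have h₂ := (hg₁.add (hexp.mul (hg₂.add_const 1))).const_mul σ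
    simpa using h₁.add h₂
  have hpos : 0 < σ * c' := mul_pos hσ hc'
  have hlogh : Tendsto (fun y => Real.log (h y) / y ^ ν') atTop (nhds 0) :=
    (hh.log hpos.ne').div_atTop hpow
  have hlog : Tendsto (fun y : ℝ => Real.log y / y ^ ν') atTop (nhds 0) :=
    (isLittleO_log_rpow_atTop hν').tendsto_div_nhds_zero
  have hsum : Tendsto (fun y => t + Real.log y / y ^ ν' + Real.log (h y) / y ^ ν')
      atTop (nhds t) := by
    simpa using (hlog.const_add t).add hlogh
  refine hsum.congr' ?_
  filter_upwards [eventually_gt_atTop 0, hh.eventually (lt_mem_nhds hpos)] with y hy hhy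
  have hfac : μ + σ * y * (g₁ y + g₂ y + 1) = Real.exp (t * y ^ ν') * y * h y := by
    simp only [hdef, Real.exp_neg]
    field_simp
    ring
  have hyp : 0 < y ^ ν' := Real.rpow_pos_of_pos hy _
  rw [hfac, Real.log_mul (by positivity) hhy.ne', Real.log_mul (by positivity) hy.ne',
    Real.log_exp]
  field_simp

/-- Proposition 3, second part: if the base distribution `F` has right-tail index `ν`
(`x^ν·(1−F(x)) → c > 0`) and `g₁(x) ~ c'·e^{t·x^{ν'}}` at `+∞`, then the transformed
distribution `F ∘ f⁻¹` satisfies `(log x)^{ν/ν'}·(1 − F(f⁻¹(x))) → c·t^{ν/ν'}`. -/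
theorem tail_log_case (F : ℝ → ℝ) (hFmono : Monotone F)
    (hFlt : ∀ x : ℝ, F x < 1)
    (μ σ : ℝ) (hσ : 0 < σ) (g₁ g₂ : ℝ → ℝ)
    (hC1 : Continuous g₁ ∧ Continuous g₂ ∧
      ∀ x : ℝ, x ≠ 0 → DifferentiableAt ℝ g₁ x ∧ DifferentiableAt ℝ g₂ x)
    (hC2 : Monotone g₁ ∧ Antitone g₂)
    (hC3 : Tendsto g₁ atBot (nhds 0) ∧ Tendsto g₂ atTop (nhds 0))
    (hC4 : ∀ x : ℝ, x ≠ 0 →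
      g₁ x + x * deriv g₁ x > -(1/2) ∧ g₂ x + x * deriv g₂ x > -(1/2))
    (ν c : ℝ) (hν : 0 < ν) (hc : 0 < c)
    (hFtail : Tendsto (fun x : ℝ => x ^ ν * (1 - F x)) atTop (nhds c))
    (t ν' c' : ℝ) (ht : 0 < t) (hν' : 0 < ν') (hc' : 0 < c')
    (hg₁tail : Tendsto (fun x : ℝ => Real.exp (-(t * x ^ ν')) * g₁ x) atTop (nhds c')) :
    Tendsto (fun x : ℝ => (Real.log x) ^ (ν / ν') *
        (1 - F (Function.invFun (fun y : ℝ => μ + σ * y * (g₁ y + g₂ y + 1)) x)))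
      atTop (nhds (c * t ^ (ν / ν'))) := by
  obtain ⟨hg₁c, hg₂c, -⟩ := hC1
  have hg₁0 : ∀ y, 0 ≤ g₁ y := hC2.1.le_of_tendsto hC3.1
  have hg₂0 : ∀ y, 0 ≤ g₂ y := hC2.2.le_of_tendsto hC3.2
  set f : ℝ → ℝ := fun y => μ + σ * y * (g₁ y + g₂ y + 1) with hf
  have hcont : Continuous f := by fun_prop
  have htop : Tendsto f atTop atTop := by
    refine tendsto_atTop_mono' _ ?_ (tendsto_atTop_add_const_left _ μ (tendsto_id.const_mul_atTop hσ))
    filter_upwards [eventually_ge_atTop 0] with y hy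
    have := mul_nonneg (mul_nonneg hσ.le hy) (add_nonneg (hg₁0 y) (hg₂0 y))
    simp only [hf, id]
    linarith
  have hbdd : ∀ A, ∃ B, ∀ y ≤ A, f y ≤ B := by
    intro A
    obtain ⟨B, hB⟩ := (isCompact_Icc (a := 0) (b := A)).bddAbove_image hcont.continuousOn
    refine ⟨max μ B, fun y hy => ?_⟩
    rcases le_total 0 y with h0 | h0
    · exact le_max_of_le_right (hB ⟨y, ⟨h0, hy⟩, rfl⟩)
    · refine le_max_of_le_left ?_
      have := mul_nonneg (mul_nonneg hσ.le (neg_nonneg.2 h0))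
        (add_nonneg (add_nonneg (hg₁0 y) (hg₂0 y)) zero_le_one)
      simp only [hf]
      linarith
  have hinv := eventually_apply_invFun_of_tendsto_atTop hcont htop
  have hlog : Tendsto (fun y => Real.log (f y) / y ^ ν') atTop (nhds t) :=
    tendsto_log_div_rpow hσ ht hν' hc' hC3.2 hg₁tail
  have hmain : Tendsto (fun y => Real.log (f y) ^ (ν / ν') * (1 - F y)) atTop
      (nhds (c * t ^ (ν / ν'))) := by
    refine (hFtail.mul (hlog.rpow_const (Or.inl ht.ne'))).congr' ?_
    filter_upwards [eventually_gt_atTop 0, hlog.eventually (lt_mem_nhds ht)] with y hy hly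
    have hyp : 0 < y ^ ν' := Real.rpow_pos_of_pos hy _
    have hpow : y ^ ν = (y ^ ν') ^ (ν / ν') := by
      rw [← Real.rpow_mul hy.le, mul_div_cancel₀ _ hν'.ne']
    have hsplit : Real.log (f y) ^ (ν / ν') = (Real.log (f y) / y ^ ν') ^ (ν / ν') * y ^ ν := by
      rw [hpow, ← Real.mul_rpow hly.le hyp.le, div_mul_cancel₀ _ hyp.ne']
    rw [hsplit]
    ring
  refine (hmain.comp (tendsto_atTop_of_eventually_rightInverse hbdd hinv)).congr' ?_
  filter_upwards [hinv] with x hx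
  simp only [Function.comp_apply, hx]
end

section
/- Let F : ℝ → ℝ be a cumulative distribution function with F(x) < 1 for all x, let μ ∈ ℝ, σ > 0, and let g₁, g₂ : ℝ → ℝ satisfy conditions (C1)–(C4), so that f(x) = μ + σ·x·(g₁(x) + g₂(x) + 1) is a strictly increasing bijection of ℝ with inverse f⁻¹. Suppose F has a Gaussian right tail, i.e., there is c > 0 with x·e^{x²/2}·(1 − F(x)) → c as x → +∞, and suppose there are ν > 0, c' > 0 with x^{1−ν}·e^{−ν x²/2}·g₁(x) → c' as x → +∞. Then x^{1/ν}·(1 − F(f⁻¹(x))) → c·(σ·c')^{1/ν} as x → +∞; in particular, the distribution F ∘ f⁻¹ has right-tail index 1/ν. (Proposition 4(i)) -/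
open Filter Real Set

open Topology

/-- A Gaussian factor dominates every power at `+∞`. -/
lemma tendsto_rpow_mul_exp_neg_sq_half {ν : ℝ} (hν : 0 < ν) (s : ℝ) :
    Tendsto (fun x : ℝ => x ^ s * Real.exp (-(ν * x ^ 2 / 2))) atTop (𝓝 0) := by
  have hexp : Tendsto (fun x : ℝ => Real.exp (-(1 / 2) * x)) atTop (𝓝 0) :=
    Real.tendsto_exp_atBot.comp
      (tendsto_id.const_mul_atTop_of_neg (by norm_num : (-(1 / 2) : ℝ) < 0))
  refine ((rpow_mul_exp_neg_mul_sq_isLittleO_exp_neg (half_pos hν) s).trans_tendsto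
    hexp).congr fun x => ?_
  congr 2
  ring

/-- If a continuous `f` tends to `+∞` at `+∞` and is bounded above on every half-line `(-∞, M]`,
then `Function.invFun f` is eventually a right inverse of `f` and tends to `+∞`. -/
lemma invFun_eventually_rightInverse_and_tendsto {f : ℝ → ℝ} (hf : Continuous f)
    (htop : Tendsto f atTop atTop) (hbdd : ∀ M, ∃ B, ∀ y ≤ M, f y ≤ B) :
    (∀ᶠ x in atTop, f (Function.invFun f x) = x) ∧ Tendsto (Function.invFun f) atTop atTop := by
  have hright : ∀ᶠ x in atTop, f (Function.invFun f x) = x := by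
    filter_upwards [eventually_ge_atTop (f 0)] with x hx
    obtain ⟨b, hb0, hb⟩ := ((eventually_ge_atTop (0 : ℝ)).and
      (htop.eventually_ge_atTop x)).exists
    obtain ⟨y, -, hy⟩ := intermediate_value_Icc hb0 hf.continuousOn ⟨hx, hb⟩
    exact Function.invFun_eq ⟨y, hy⟩
  refine ⟨hright, tendsto_atTop.2 fun M => ?_⟩
  obtain ⟨B, hB⟩ := hbdd M
  filter_upwards [hright, eventually_gt_atTop B] with x hx hxB
  by_contra! h
  linarith [hB _ h.le]

/-- Proposition 4(i): if the base distribution `F` has a Gaussian right tail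
(`x·e^{x²/2}·(1−F(x)) → c > 0`) and `g₁(x) ~ c'·x^{ν−1}·e^{ν x²/2}` at `+∞`,
then `x^{1/ν}·(1 − F(f⁻¹(x))) → c·(σc')^{1/ν}`, i.e. `F ∘ f⁻¹` has right-tail
index `1/ν`. -/
theorem tail_index_gaussian_base (F : ℝ → ℝ) (hFmono : Monotone F)
    (hFlt : ∀ x : ℝ, F x < 1)
    (μ σ : ℝ) (hσ : 0 < σ) (g₁ g₂ : ℝ → ℝ)
    (hC1 : Continuous g₁ ∧ Continuous g₂ ∧
      ∀ x : ℝ, x ≠ 0 → DifferentiableAt ℝ g₁ x ∧ DifferentiableAt ℝ g₂ x)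
    (hC2 : Monotone g₁ ∧ Antitone g₂)
    (hC3 : Tendsto g₁ atBot (nhds 0) ∧ Tendsto g₂ atTop (nhds 0))
    (hC4 : ∀ x : ℝ, x ≠ 0 →
      g₁ x + x * deriv g₁ x > -(1/2) ∧ g₂ x + x * deriv g₂ x > -(1/2))
    (c : ℝ) (hc : 0 < c)
    (hFtail : Tendsto (fun x : ℝ => x * Real.exp (x ^ 2 / 2) * (1 - F x)) atTop (nhds c))
    (ν c' : ℝ) (hν : 0 < ν) (hc' : 0 < c')
    (hg₁tail : Tendsto (fun x : ℝ => x ^ (1 - ν) * Real.exp (-(ν * x ^ 2 / 2)) * g₁ x)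
      atTop (nhds c')) :
    Tendsto (fun x : ℝ => x ^ (1 / ν) *
        (1 - F (Function.invFun (fun y : ℝ => μ + σ * y * (g₁ y + g₂ y + 1)) x)))
      atTop (nhds (c * (σ * c') ^ (1 / ν))) := by
  obtain ⟨hg₁cont, hg₂cont, -⟩ := hC1
  obtain ⟨hg₁mono, hg₂anti⟩ := hC2
  obtain ⟨hg₁bot, hg₂top⟩ := hC3
  have hg₁ : ∀ y, 0 ≤ g₁ y := fun y => hg₁mono.le_of_tendsto hg₁bot y
  have hg₂ : ∀ y, 0 ≤ g₂ y := fun y => hg₂anti.le_of_tendsto hg₂top y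
  set f : ℝ → ℝ := fun y => μ + σ * y * (g₁ y + g₂ y + 1) with hf
  have hfcont : Continuous f := by fun_prop
  have hftop : Tendsto f atTop atTop := by
    refine tendsto_atTop_mono' atTop ?_
      (tendsto_atTop_add_const_left atTop μ (tendsto_id.const_mul_atTop hσ))
    filter_upwards [eventually_ge_atTop 0] with y hy
    have : σ * y ≤ σ * y * (g₁ y + g₂ y + 1) :=
      le_mul_of_one_le_right (by positivity) (by linarith [hg₁ y, hg₂ y])
    simpa [hf] using this
  have hfbdd : ∀ M, ∃ B, ∀ y ≤ M, f y ≤ B := by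
    intro M
    obtain ⟨B, hB⟩ := (isCompact_Icc (a := 0) (b := M)).bddAbove_image hfcont.continuousOn
    refine ⟨max μ B, fun y hy => ?_⟩
    rcases le_total y 0 with h | h
    · refine le_max_of_le_left ?_
      have : σ * y * (g₁ y + g₂ y + 1) ≤ 0 :=
        mul_nonpos_of_nonpos_of_nonneg (mul_nonpos_of_nonneg_of_nonpos hσ.le h)
          (by linarith [hg₁ y, hg₂ y])
      simpa [hf] using this
    · exact le_max_of_le_right (hB ⟨y, ⟨h, hy⟩, rfl⟩)
  obtain ⟨hright, hinv⟩ := invFun_eventually_rightInverse_and_tendsto hfcont hftop hfbdd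
  have hscaled : Tendsto (fun y : ℝ => f y * (y ^ (-ν) * Real.exp (-(ν * y ^ 2 / 2)))) atTop
      (𝓝 (σ * c')) := by
    have hlim := (((tendsto_rpow_mul_exp_neg_sq_half hν (-ν)).const_mul μ).add
      (hg₁tail.const_mul σ)).add (((tendsto_rpow_mul_exp_neg_sq_half hν (1 - ν)).mul
        (hg₂top.add_const 1)).const_mul σ)
    simp only [mul_zero, zero_mul, zero_add, add_zero] at hlim
    refine hlim.congr' ?_
    filter_upwards [eventually_gt_atTop 0] with y hy
    have hpow : y ^ (1 - ν) = y * y ^ (-ν) := by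
      rw [sub_eq_add_neg, Real.rpow_add hy, Real.rpow_one]
    rw [hpow, hf]
    ring
  have hcomp : Tendsto (fun y : ℝ => f y ^ (1 / ν) * (1 - F y)) atTop
      (𝓝 (c * (σ * c') ^ (1 / ν))) := by
    have hlim := hFtail.mul (hscaled.rpow_const (p := 1 / ν) (Or.inr (by positivity)))
    refine hlim.congr' ?_
    filter_upwards [eventually_gt_atTop 0, hftop.eventually_ge_atTop 0] with y hy hfy
    have hweight : (y ^ (-ν) * Real.exp (-(ν * y ^ 2 / 2))) ^ (1 / ν) =
        y⁻¹ * (Real.exp (y ^ 2 / 2))⁻¹ := by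
      rw [Real.mul_rpow (by positivity) (by positivity), ← Real.rpow_mul hy.le, ← Real.exp_mul,
        ← Real.exp_neg, ← Real.rpow_neg_one]
      congr 2 <;> field_simp
    rw [Real.mul_rpow hfy (by positivity), hweight]
    field_simp
  refine (hcomp.comp hinv).congr' ?_
  filter_upwards [hright] with x hx
  simp only [Function.comp_apply, hx]
end

section
/- Let F : ℝ → ℝ be a cumulative distribution function with F(x) < 1 for all x, let μ ∈ ℝ, σ > 0, and let g₁, g₂ : ℝ → ℝ satisfy conditions (C1)–(C4), so that f(x) = μ + σ·x·(g₁(x) + g₂(x) + 1) is a strictly increasing bijection of ℝ with inverse f⁻¹. Suppose F has an exponential right tail, i.e., there are t > 0 and c > 0 with e^{t·x}·(1 − F(x)) → c as x → +∞, and suppose there are ν > 0, c' > 0 with x·e^{−ν x}·g₁(x) → c' as x → +∞. Then x^{t/ν}·(1 − F(f⁻¹(x))) → c·(σ·c')^{t/ν} as x → +∞; in particular, the distribution F ∘ f⁻¹ has right-tail index t/ν. (Proposition 4(ii)) -/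
open Filter Real Set

/-- A continuous real function tending to `+∞` at `+∞` and bounded above on every left half-line
is eventually inverted from the right by `Function.invFun`, which also tends to `+∞`. -/
theorem tendsto_invFun_atTop_of_bddAbove {f : ℝ → ℝ} (hf : Continuous f)
    (htop : Tendsto f atTop atTop) (hbdd : ∀ M, BddAbove (f '' Iic M)) :
    (∀ᶠ x in atTop, f (Function.invFun f x) = x) ∧
      Tendsto (Function.invFun f) atTop atTop := by
  have hinv : ∀ᶠ x in atTop, f (Function.invFun f x) = x := by
    filter_upwards [eventually_ge_atTop (f 0)] with x hx
    apply Function.invFun_eq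
    obtain ⟨b, hb, hb0⟩ := ((htop.eventually_ge_atTop x).and (eventually_ge_atTop 0)).exists
    obtain ⟨y, -, hy⟩ := intermediate_value_Icc hb0 hf.continuousOn ⟨hx, hb⟩
    exact ⟨y, hy⟩
  refine ⟨hinv, tendsto_atTop.2 fun M => ?_⟩
  obtain ⟨B, hB⟩ := hbdd M
  filter_upwards [hinv, eventually_gt_atTop B] with x hx hxB
  by_contra! hlt
  have := hB (mem_image_of_mem f (mem_Iic.2 hlt.le))
  linarith

/-- Proposition 4(ii): if the base distribution `F` has an exponential right tail
(`e^{t·x}·(1−F(x)) → c > 0`) and `g₁(x) ~ c'·x⁻¹·e^{ν x}` at `+∞`, then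
`x^{t/ν}·(1 − F(f⁻¹(x))) → c·(σc')^{t/ν}`, i.e. `F ∘ f⁻¹` has right-tail index `t/ν`. -/
theorem tail_index_exponential_base (F : ℝ → ℝ) (hFmono : Monotone F)
    (hFlt : ∀ x : ℝ, F x < 1)
    (μ σ : ℝ) (hσ : 0 < σ) (g₁ g₂ : ℝ → ℝ)
    (hC1 : Continuous g₁ ∧ Continuous g₂ ∧
      ∀ x : ℝ, x ≠ 0 → DifferentiableAt ℝ g₁ x ∧ DifferentiableAt ℝ g₂ x)
    (hC2 : Monotone g₁ ∧ Antitone g₂)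
    (hC3 : Tendsto g₁ atBot (nhds 0) ∧ Tendsto g₂ atTop (nhds 0))
    (hC4 : ∀ x : ℝ, x ≠ 0 →
      g₁ x + x * deriv g₁ x > -(1/2) ∧ g₂ x + x * deriv g₂ x > -(1/2))
    (t c : ℝ) (ht : 0 < t) (hc : 0 < c)
    (hFtail : Tendsto (fun x : ℝ => Real.exp (t * x) * (1 - F x)) atTop (nhds c))
    (ν c' : ℝ) (hν : 0 < ν) (hc' : 0 < c')
    (hg₁tail : Tendsto (fun x : ℝ => x * Real.exp (-(ν * x)) * g₁ x) atTop (nhds c')) :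
    Tendsto (fun x : ℝ => x ^ (t / ν) *
        (1 - F (Function.invFun (fun y : ℝ => μ + σ * y * (g₁ y + g₂ y + 1)) x)))
      atTop (nhds (c * (σ * c') ^ (t / ν))) := by
  obtain ⟨hg₁cont, hg₂cont, -⟩ := hC1
  obtain ⟨hg₁mono, hg₂anti⟩ := hC2
  obtain ⟨hg₁bot, hg₂top⟩ := hC3
  have hg₁nonneg : ∀ y, 0 ≤ g₁ y := hg₁mono.le_of_tendsto hg₁bot
  have hg₂nonneg : ∀ y, 0 ≤ g₂ y := hg₂anti.le_of_tendsto hg₂top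
  set f : ℝ → ℝ := fun y => μ + σ * y * (g₁ y + g₂ y + 1) with hf
  have hfcont : Continuous f := by fun_prop
  have hftop : Tendsto f atTop atTop := by
    refine tendsto_atTop_mono' atTop ?_
      (tendsto_atTop_add_const_left atTop μ (tendsto_id.const_mul_atTop hσ))
    filter_upwards [eventually_ge_atTop 0] with y hy
    have := mul_nonneg (mul_nonneg hσ.le hy) (add_nonneg (hg₁nonneg y) (hg₂nonneg y))
    simp only [hf, id]
    linarith
  have hfbdd : ∀ M, BddAbove (f '' Iic M) := by
    refine fun M => ⟨μ + σ * |M| * (g₁ M + g₂ 0 + 1), ?_⟩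
    rintro _ ⟨y, hy, rfl⟩
    have h0 : 0 ≤ g₁ M + g₂ 0 + 1 := by linarith [hg₁nonneg M, hg₂nonneg 0]
    have h1 : 0 ≤ g₁ y + g₂ y + 1 := by linarith [hg₁nonneg y, hg₂nonneg y]
    refine add_le_add_right ?_ μ
    rcases le_total y 0 with hy0 | hy0
    · exact (mul_nonpos_of_nonpos_of_nonneg (mul_nonpos_of_nonneg_of_nonpos hσ.le hy0) h1).trans
        (by positivity)
    · have hyM : y ≤ |M| := (mem_Iic.1 hy).trans (le_abs_self M)
      have hg₁y := hg₁mono (mem_Iic.1 hy)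
      have hg₂y := hg₂anti hy0
      gcongr
  obtain ⟨hinv, hinvtop⟩ := tendsto_invFun_atTop_of_bddAbove hfcont hftop hfbdd
  have hexp : Tendsto (fun y : ℝ => Real.exp (-(ν * y))) atTop (nhds 0) :=
    tendsto_exp_neg_atTop_nhds_zero.comp (tendsto_id.const_mul_atTop hν)
  have hyexp : Tendsto (fun y : ℝ => y * Real.exp (-(ν * y))) atTop (nhds 0) := by
    simpa using tendsto_rpow_mul_exp_neg_mul_atTop_nhds_zero 1 ν hν
  have hfexp : Tendsto (fun y => f y * Real.exp (-(ν * y))) atTop (nhds (σ * c')) := by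
    have h := ((hexp.const_mul μ).add (hg₁tail.const_mul σ)).add
      ((hyexp.mul (hg₂top.add_const 1)).const_mul σ)
    simp only [mul_zero, zero_mul, zero_add, add_zero] at h
    refine h.congr fun y => ?_
    simp only [hf]
    ring
  have hlim : Tendsto (fun y => f y ^ (t / ν) * (1 - F y)) atTop
      (nhds (c * (σ * c') ^ (t / ν))) := by
    have h := hFtail.mul (hfexp.rpow_const (p := t / ν) (Or.inr (by positivity)))
    refine h.congr' ?_
    filter_upwards [hftop.eventually_ge_atTop 0] with y hy
    have hpow : Real.exp (-(ν * y)) ^ (t / ν) = Real.exp (-(t * y)) := by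
      rw [← Real.exp_mul]
      congr 1
      field_simp
    have hone : Real.exp (t * y) * Real.exp (-(t * y)) = 1 := by
      rw [← Real.exp_add, add_neg_cancel, Real.exp_zero]
    rw [Real.mul_rpow hy (Real.exp_pos _).le, hpow]
    linear_combination (f y ^ (t / ν) * (1 - F y)) * hone
  refine (hlim.comp hinvtop).congr' ?_
  filter_upwards [hinv] with x hx
  simp only [Function.comp_apply, hx]
end

section
/- Let F : ℝ → ℝ be a cumulative distribution function with F(x) < 1 for all x, let μ ∈ ℝ, σ > 0, and let g₁, g₂ : ℝ → ℝ satisfy conditions (C1)–(C4) together with g₁(x) → +∞ as x → +∞, and set f(x) = μ + σ·x·(g₁(x) + g₂(x) + 1). If there exists ρ < 0 such that for every t > 0, (1 − F(t·x))/(1 − F(x)) → t^ρ as x → +∞ (i.e., 1 − F is regularly varying with negative index), then the distribution with cumulative function F ∘ f⁻¹ has a heavier right tail than F: for every μ' ∈ ℝ and σ' > 0, (1 − F(f⁻¹(x)))/(1 − F((x − μ')/σ')) → +∞ as x → +∞. (Proposition 5, condition a) -/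
open Filter Real Set

/-- If `h → +∞`, every preimage of a large `x` under `y ↦ μ + σ * y * h y` is at most `ε * x`. -/
theorem eventually_forall_preimage_le_mul {h : ℝ → ℝ} (hh : Tendsto h atTop atTop)
    (μ : ℝ) {σ ε : ℝ} (hσ : 0 < σ) (hε : 0 < ε) :
    ∀ᶠ x : ℝ in atTop, ∀ y : ℝ, μ + σ * y * h y = x → y ≤ ε * x := by
  obtain ⟨Y, hY⟩ := eventually_atTop.1 (hh.eventually_ge_atTop (2 / (σ * ε)))
  filter_upwards [eventually_ge_atTop (Y / ε), eventually_ge_atTop (-μ),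
    eventually_ge_atTop 0] with x hxY hxμ hx0 y hy
  rcases le_total y 0 with hy0 | hy0
  · exact hy0.trans (by positivity)
  rcases le_total y Y with hyY | hyY
  · rw [div_le_iff₀ hε] at hxY
    linarith
  have hmul : σ * y * (2 / (σ * ε)) ≤ σ * y * h y :=
    mul_le_mul_of_nonneg_left (hY y hyY) (by positivity)
  have hsimp : σ * y * (2 / (σ * ε)) = 2 * y / ε := by
    field_simp
  rw [hsimp, div_le_iff₀ hε] at hmul
  nlinarith

/-- A real power with negative exponent takes arbitrarily large values on `(0, ∞)`. -/
theorem exists_pos_lt_rpow_of_neg {ρ : ℝ} (hρ : ρ < 0) (K : ℝ) : ∃ t : ℝ, 0 < t ∧ K < t ^ ρ := by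
  have hK : 0 < |K| + 1 := by positivity
  refine ⟨(|K| + 1) ^ ρ⁻¹, rpow_pos_of_pos hK _, ?_⟩
  rw [rpow_inv_rpow hK.le hρ.ne]
  linarith [le_abs_self K]

/-- Proposition 5, condition a): if `1 − F` is regularly varying with negative index
and `g₁(x) → +∞`, then the transformed distribution `F ∘ f⁻¹` has a heavier right
tail than `F`. -/
theorem heavier_tail_regularly_varying (F : ℝ → ℝ) (hFmono : Monotone F)
    (hFlt : ∀ x : ℝ, F x < 1)
    (μ σ : ℝ) (hσ : 0 < σ) (g₁ g₂ : ℝ → ℝ)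
    (hC1 : Continuous g₁ ∧ Continuous g₂ ∧
      ∀ x : ℝ, x ≠ 0 → DifferentiableAt ℝ g₁ x ∧ DifferentiableAt ℝ g₂ x)
    (hC2 : Monotone g₁ ∧ Antitone g₂)
    (hC3 : Tendsto g₁ atBot (nhds 0) ∧ Tendsto g₂ atTop (nhds 0))
    (hC4 : ∀ x : ℝ, x ≠ 0 →
      g₁ x + x * deriv g₁ x > -(1/2) ∧ g₂ x + x * deriv g₂ x > -(1/2))
    (hg₁top : Tendsto g₁ atTop atTop)
    (hRV : ∃ ρ : ℝ, ρ < 0 ∧ ∀ t : ℝ, 0 < t →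
      Tendsto (fun x : ℝ => (1 - F (t * x)) / (1 - F x)) atTop (nhds (t ^ ρ))) :
    ∀ μ' σ' : ℝ, 0 < σ' →
      Tendsto (fun x : ℝ =>
          (1 - F (Function.invFun (fun y : ℝ => μ + σ * y * (g₁ y + g₂ y + 1)) x)) /
          (1 - F ((x - μ') / σ')))
        atTop atTop := by
  intro μ' σ' hσ'
  obtain ⟨ρ, hρ, hRV⟩ := hRV
  set f : ℝ → ℝ := fun y => μ + σ * y * (g₁ y + g₂ y + 1)
  have hh : Tendsto (fun y => g₁ y + g₂ y + 1) atTop atTop :=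
    tendsto_atTop_add_const_right _ _ (hg₁top.atTop_add hC3.2)
  have hfcont : Continuous f := by
    have := hC1.1
    have := hC1.2.1
    fun_prop
  have hftop : Tendsto f atTop atTop :=
    tendsto_atTop_add_const_left _ _
      ((tendsto_id.const_mul_atTop hσ).atTop_mul_atTop₀ hh)
  have hinv : ∀ᶠ x in atTop, f (Function.invFun f x) = x := by
    filter_upwards [eventually_ge_atTop (f 0)] with x hx
    obtain ⟨b, hb, hb0⟩ :=
      ((hftop.eventually_ge_atTop x).and (eventually_ge_atTop 0)).exists
    obtain ⟨y, -, hy⟩ := intermediate_value_Icc hb0 hfcont.continuousOn ⟨hx, hb⟩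
    exact Function.invFun_eq ⟨y, hy⟩
  refine tendsto_atTop.2 fun K => ?_
  obtain ⟨t, ht, hKt⟩ := exists_pos_lt_rpow_of_neg hρ K
  set c : ℝ := (2 * σ')⁻¹ with hc
  have hcpos : 0 < c := by positivity
  have hratio : ∀ᶠ x : ℝ in atTop, K < (1 - F (t * (c * x))) / (1 - F (c * x)) :=
    (tendsto_id.const_mul_atTop hcpos).eventually ((hRV t ht).eventually_const_lt hKt)
  filter_upwards [hinv, hratio, eventually_ge_atTop (2 * μ'),
    eventually_forall_preimage_le_mul hh μ hσ (mul_pos ht hcpos)] with x hx hK hxμ hle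
  have hnum : F (Function.invFun f x) ≤ F (t * (c * x)) :=
    hFmono (by rw [← mul_assoc]; exact hle _ hx)
  have hden : F (c * x) ≤ F ((x - μ') / σ') := by
    refine hFmono ?_
    rw [le_div_iff₀ hσ']
    have : c * x * σ' = x / 2 := by
      rw [hc]
      field_simp
    linarith
  refine hK.le.trans (div_le_div₀ ?_ ?_ ?_ ?_)
  · linarith [hFlt (Function.invFun f x)]
  · linarith
  · linarith [hFlt ((x - μ') / σ')]
  · linarith
end

section
/- Let F : ℝ → ℝ be a cumulative distribution function with F(x) < 1 for all x, let μ ∈ ℝ, σ > 0, and let g₁, g₂ : ℝ → ℝ satisfy conditions (C1)–(C4) together with g₁(x) → +∞ as x → +∞, and set f(x) = μ + σ·x·(g₁(x) + g₂(x) + 1). If there exists t > 1 such that (1 − F(t·x))/(1 − F(x)) → 0 as x → +∞, then the distribution with cumulative function F ∘ f⁻¹ has a heavier right tail than F: for every μ' ∈ ℝ and σ' > 0, (1 − F(f⁻¹(x)))/(1 − F((x − μ')/σ')) → +∞ as x → +∞. (Proposition 5, condition b) -/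
open Filter Real Set

/-- A right inverse of a function bounded above on every `Iic M` tends to infinity. -/
theorem tendsto_atTop_of_rightInverse_of_bddAbove_Iic {f h : ℝ → ℝ}
    (hfh : Function.RightInverse h f) (hf : ∀ M, ∃ B, ∀ y ≤ M, f y ≤ B) :
    Tendsto h atTop atTop := by
  refine tendsto_atTop.2 fun M => ?_
  obtain ⟨B, hB⟩ := hf M
  filter_upwards [eventually_gt_atTop B] with x hx
  by_contra! hlt
  have := hB _ hlt.le
  rw [hfh x] at this
  linarith

/-- If the tail of `F` decays rapidly along the dilation by `t`, then composing `F` with a map `h`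
tending to infinity with `t * h x ≤ k x` eventually gives a tail dominating that of `F ∘ k`. -/
theorem tendsto_tail_ratio_atTop {F h k : ℝ → ℝ} {t : ℝ} (hFmono : Monotone F)
    (hFlt : ∀ x, F x < 1)
    (hF : Tendsto (fun x => (1 - F (t * x)) / (1 - F x)) atTop (nhds 0))
    (hh : Tendsto h atTop atTop) (hk : ∀ᶠ x in atTop, t * h x ≤ k x) :
    Tendsto (fun x => (1 - F (h x)) / (1 - F (k x))) atTop atTop := by
  have hpos : ∀ x, 0 < 1 - F x := fun x => sub_pos.2 (hFlt x)
  have hinv : Tendsto (fun x => ((1 - F (t * x)) / (1 - F x))⁻¹) atTop atTop :=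
    (tendsto_nhdsWithin_iff.2
      ⟨hF, Eventually.of_forall fun x => div_pos (hpos _) (hpos _)⟩).inv_tendsto_nhdsGT_zero
  refine tendsto_atTop_mono' _ ?_ (hinv.comp hh)
  filter_upwards [hk] with x hx
  simp only [Function.comp_apply, inv_div]
  exact div_le_div_of_nonneg_left (hpos _).le (hpos _) (sub_le_sub_left (hFmono hx) 1)

/-- Proposition 5, condition b): if there is `t > 1` with
`(1 − F(t·x))/(1 − F(x)) → 0` and `g₁(x) → +∞`, then the transformed distribution
`F ∘ f⁻¹` has a heavier right tail than `F`. -/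
theorem heavier_tail_rapid_decay (F : ℝ → ℝ) (hFmono : Monotone F)
    (hFlt : ∀ x : ℝ, F x < 1)
    (μ σ : ℝ) (hσ : 0 < σ) (g₁ g₂ : ℝ → ℝ)
    (hC1 : Continuous g₁ ∧ Continuous g₂ ∧
      ∀ x : ℝ, x ≠ 0 → DifferentiableAt ℝ g₁ x ∧ DifferentiableAt ℝ g₂ x)
    (hC2 : Monotone g₁ ∧ Antitone g₂)
    (hC3 : Tendsto g₁ atBot (nhds 0) ∧ Tendsto g₂ atTop (nhds 0))
    (hC4 : ∀ x : ℝ, x ≠ 0 →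
      g₁ x + x * deriv g₁ x > -(1/2) ∧ g₂ x + x * deriv g₂ x > -(1/2))
    (hg₁top : Tendsto g₁ atTop atTop)
    (hcond : ∃ t : ℝ, 1 < t ∧
      Tendsto (fun x : ℝ => (1 - F (t * x)) / (1 - F x)) atTop (nhds 0)) :
    ∀ μ' σ' : ℝ, 0 < σ' →
      Tendsto (fun x : ℝ =>
          (1 - F (Function.invFun (fun y : ℝ => μ + σ * y * (g₁ y + g₂ y + 1)) x)) /
          (1 - F ((x - μ') / σ')))
        atTop atTop := by
  obtain ⟨t, -, ht⟩ := hcond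
  intro μ' σ' hσ'
  have hg₁ : ∀ y, 0 ≤ g₁ y := hC2.1.le_of_tendsto hC3.1
  have hg₂ : ∀ y, 0 ≤ g₂ y := hC2.2.le_of_tendsto hC3.2
  set f : ℝ → ℝ := fun y => μ + σ * y * (g₁ y + g₂ y + 1) with hf
  have hcont : Continuous f := by
    have h₁ := hC1.1
    have h₂ := hC1.2.1
    fun_prop
  have hlin_top : Tendsto (fun y : ℝ => μ + σ * y) atTop atTop :=
    tendsto_atTop_add_const_left _ _ (tendsto_id.const_mul_atTop hσ)
  have hlin_bot : Tendsto (fun y : ℝ => μ + σ * y) atBot atBot :=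
    tendsto_atBot_add_const_left _ _ (tendsto_id.const_mul_atBot hσ)
  have hf_top : Tendsto f atTop atTop := by
    refine tendsto_atTop_mono' _ ?_ hlin_top
    filter_upwards [eventually_ge_atTop 0] with y hy
    have := mul_nonneg (mul_nonneg hσ.le hy) (add_nonneg (hg₁ y) (hg₂ y))
    simp only [hf]
    linarith
  have hf_bot : Tendsto f atBot atBot := by
    refine tendsto_atBot_mono' _ ?_ hlin_bot
    filter_upwards [eventually_le_atBot 0] with y hy
    have := mul_nonneg (mul_nonneg hσ.le (neg_nonneg.2 hy)) (add_nonneg (hg₁ y) (hg₂ y))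
    simp only [hf]
    linarith
  have hright : Function.RightInverse (Function.invFun f) f :=
    Function.rightInverse_invFun (hcont.surjective hf_top hf_bot)
  have hinv_top : Tendsto (Function.invFun f) atTop atTop := by
    refine tendsto_atTop_of_rightInverse_of_bddAbove_Iic hright fun M => ?_
    refine ⟨μ + σ * |M| * (g₁ |M| + g₂ 0 + 1), fun y hy => ?_⟩
    have hM := add_nonneg (add_nonneg (hg₁ |M|) (hg₂ 0)) zero_le_one
    have hyM : y ≤ |M| := hy.trans (le_abs_self M)
    simp only [hf, add_le_add_iff_left]
    rcases le_total y 0 with h0 | h0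
    · have hy1 := add_nonneg (add_nonneg (hg₁ y) (hg₂ y)) zero_le_one
      exact (mul_nonpos_of_nonpos_of_nonneg (mul_nonpos_of_nonneg_of_nonpos hσ.le h0) hy1).trans
        (by positivity)
    · have h₁ := hC2.1 hyM
      have h₂ := hC2.2 h0
      have hy1 := add_nonneg (add_nonneg (hg₁ y) (hg₂ y)) zero_le_one
      gcongr
  refine tendsto_tail_ratio_atTop hFmono hFlt ht hinv_top ?_
  have hdom : ∀ᶠ y in atTop, t * y ≤ (f y - μ') / σ' := by
    filter_upwards [eventually_ge_atTop 1,
      hg₁top.eventually_ge_atTop ((t * σ' + |μ' - μ|) / σ)] with y hy hgy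
    rw [div_le_iff₀ hσ] at hgy
    rw [le_div_iff₀ hσ']
    have h₁ := mul_le_mul_of_nonneg_left hgy (zero_le_one.trans hy)
    have h₂ := mul_le_mul_of_nonneg_right hy (abs_nonneg (μ' - μ))
    have h₃ := mul_nonneg (mul_nonneg hσ.le (zero_le_one.trans hy))
      (add_nonneg (hg₂ y) zero_le_one)
    simp only [hf]
    linarith [le_abs_self (μ' - μ)]
  filter_upwards [hinv_top.eventually hdom] with x hx
  rwa [hright x] at hx
end

section
/- Let F₁ and F₂ be cumulative distribution functions on ℝ that are continuous and strictly increasing on ℝ, with quantile functions F₁⁻¹ and F₂⁻¹ satisfying F₁⁻¹(α) → +∞ as α → 1⁻. Suppose F₂ has a heavier right tail than F₁, i.e., for every μ ∈ ℝ and σ > 0, (1 − F₂(x))/(1 − F₁((x − μ)/σ)) → +∞ as x → +∞. Then F₂⁻¹(α)/F₁⁻¹(α) → +∞ as α → 1⁻; equivalently, F₂⁻¹(F₁(x))/x → +∞ as x → +∞. -/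
open Filter Real Set

/-- If `F₂` has a heavier right tail than `F₁` (both continuous strictly increasing
CDFs with values in `(0,1)`), and `F₁⁻¹(α) → +∞` as `α → 1⁻`, then
`F₂⁻¹(α)/F₁⁻¹(α) → +∞` as `α → 1⁻`; equivalently `F₂⁻¹(F₁(x))/x → +∞` as `x → +∞`. -/
theorem quantile_ratio_tendsto_atTop
    (F₁ F₂ : ℝ → ℝ) (hF₁cont : Continuous F₁) (hF₂cont : Continuous F₂)
    (hF₁mono : StrictMono F₁) (hF₂mono : StrictMono F₂)
    (hF₁range : ∀ x : ℝ, F₁ x ∈ Set.Ioo (0 : ℝ) 1)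
    (hF₂range : ∀ x : ℝ, F₂ x ∈ Set.Ioo (0 : ℝ) 1)
    (Finv₁ Finv₂ : ℝ → ℝ)
    (hFinv₁ : ∀ α ∈ Set.Ioo (0 : ℝ) 1, F₁ (Finv₁ α) = α)
    (hFinv₂ : ∀ α ∈ Set.Ioo (0 : ℝ) 1, F₂ (Finv₂ α) = α)
    (hFinv₁top : Tendsto Finv₁ (nhdsWithin 1 (Set.Iio 1)) atTop)
    (hheavier : ∀ μ σ : ℝ, 0 < σ →
      Tendsto (fun x : ℝ => (1 - F₂ x) / (1 - F₁ ((x - μ) / σ))) atTop atTop) :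
    Tendsto (fun α : ℝ => Finv₂ α / Finv₁ α) (nhdsWithin 1 (Set.Iio 1)) atTop ∧
    Tendsto (fun x : ℝ => Finv₂ (F₁ x) / x) atTop atTop := by
  have key : Tendsto (fun x : ℝ => Finv₂ (F₁ x) / x) atTop atTop := by
    refine tendsto_atTop.2 fun C => ?_
    have hσ : 0 < max C 1 := lt_max_of_lt_right one_pos
    have hscale : Tendsto (fun x : ℝ => max C 1 * x) atTop atTop :=
      tendsto_id.const_mul_atTop hσ
    filter_upwards [hscale.eventually ((hheavier 0 (max C 1) hσ).eventually_gt_atTop 1),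
      eventually_gt_atTop 0] with x hx hx0
    have harg : (max C 1 * x - 0) / max C 1 = x := by
      rw [sub_zero, mul_div_cancel_left₀ _ hσ.ne']
    rw [harg, one_lt_div (sub_pos.2 (hF₁range x).2)] at hx
    have hlt : max C 1 * x < Finv₂ (F₁ x) := by
      rw [← hF₂mono.lt_iff_lt, hFinv₂ _ (hF₁range x)]
      linarith
    rw [le_div_iff₀ hx0]
    exact (mul_le_mul_of_nonneg_right (le_max_left C 1) hx0.le).trans hlt.le
  refine ⟨(key.comp hFinv₁top).congr' ?_, key⟩
  filter_upwards [Ioo_mem_nhdsLT (zero_lt_one' ℝ)] with α hα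
  simp only [Function.comp_apply, hFinv₁ α hα]
end

section
/- Fix A = 4 and real parameters u ≥ 1, v ≥ 1, μ ∈ ℝ, σ > 0. Then the functions g₁(x) = u^x/A and g₂(x) = v^{−x}/A satisfy conditions (C1)–(C4) whenever u > 1 and v > 1; in particular, for any u ≥ 1, v ≥ 1 the function f(x) = μ + σ·x·(u^x/A + v^{−x}/A + 1) is strictly increasing on ℝ. -/
open Filter Real Set

/-- The function `t ↦ e^t (1 + t)` is bounded below by `-1`. -/
theorem neg_one_lt_exp_mul_one_add (t : ℝ) : -1 < exp t * (1 + t) := by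
  have h : -(1 + t) < exp (-t) := by linarith [add_one_le_exp (-t)]
  have h' := mul_lt_mul_of_pos_left h (exp_pos t)
  rw [← exp_add, add_neg_cancel, exp_zero] at h'
  linarith

theorem hasDerivAt_exp_mul_div (c A x : ℝ) :
    HasDerivAt (fun x : ℝ => exp (x * c) / A) (exp (x * c) * c / A) x := by
  simpa using (((hasDerivAt_id x).mul_const c).exp).div_const A

theorem neg_half_lt_exp_div_four_add (c x : ℝ) :
    -(1 / 2) < exp (x * c) / 4 + x * (exp (x * c) * c / 4) := by
  linarith [neg_one_lt_exp_mul_one_add (x * c)]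

/-- The quantile function `x ↦ μ + σ x (e^{ax}/4 + e^{bx}/4 + 1)` is strictly increasing for
all exponents `a` and `b`. -/
theorem strictMono_add_mul_exp_div_four (a b μ : ℝ) {σ : ℝ} (hσ : 0 < σ) :
    StrictMono fun x : ℝ => μ + σ * x * (exp (x * a) / 4 + exp (x * b) / 4 + 1) := by
  refine strictMono_of_hasDerivAt_pos (fun x => ((((hasDerivAt_id x).const_mul σ).mul
    (((hasDerivAt_exp_mul_div a 4 x).add (hasDerivAt_exp_mul_div b 4 x)).add_const 1)).const_add
      μ)) fun x => ?_
  have h : 0 < σ * ((exp (x * a) / 4 + x * (exp (x * a) * a / 4)) +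
      (exp (x * b) / 4 + x * (exp (x * b) * b / 4)) + 1) :=
    mul_pos hσ (by
      linarith [neg_half_lt_exp_div_four_add a x, neg_half_lt_exp_div_four_add b x])
  simp only [id, Pi.add_apply]
  linarith

theorem tendsto_exp_div_zero {α : Type*} {l : Filter α} {f : α → ℝ} (A : ℝ)
    (hf : Tendsto f l atBot) : Tendsto (fun x => exp (f x) / A) l (nhds 0) := by
  simpa using (tendsto_exp_atBot.comp hf).div_const A

/-- With `A = 4`, the functions `g₁(x) = u^x/A` and `g₂(x) = v^{−x}/A` satisfy
conditions (C1)–(C4) whenever `u > 1` and `v > 1`; in particular, for any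
`u ≥ 1`, `v ≥ 1`, the function `f(x) = μ + σ·x·(u^x/A + v^{−x}/A + 1)` is strictly
increasing on ℝ. -/
theorem htqf_conditions_and_strictMono (u v μ σ : ℝ) (hu : 1 ≤ u) (hv : 1 ≤ v)
    (hσ : 0 < σ) (A : ℝ) (hA : A = 4) :
    (1 < u → 1 < v →
      ((Continuous (fun x : ℝ => Real.exp (x * Real.log u) / A) ∧
        Continuous (fun x : ℝ => Real.exp (-x * Real.log v) / A) ∧
        ∀ x : ℝ, x ≠ 0 →
          DifferentiableAt ℝ (fun x : ℝ => Real.exp (x * Real.log u) / A) x ∧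
          DifferentiableAt ℝ (fun x : ℝ => Real.exp (-x * Real.log v) / A) x) ∧
      (Monotone (fun x : ℝ => Real.exp (x * Real.log u) / A) ∧
        Antitone (fun x : ℝ => Real.exp (-x * Real.log v) / A)) ∧
      (Tendsto (fun x : ℝ => Real.exp (x * Real.log u) / A) atBot (nhds 0) ∧
        Tendsto (fun x : ℝ => Real.exp (-x * Real.log v) / A) atTop (nhds 0)) ∧
      (∀ x : ℝ, x ≠ 0 →
        Real.exp (x * Real.log u) / A +
          x * deriv (fun x : ℝ => Real.exp (x * Real.log u) / A) x > -(1/2) ∧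
        Real.exp (-x * Real.log v) / A +
          x * deriv (fun x : ℝ => Real.exp (-x * Real.log v) / A) x > -(1/2)))) ∧
    StrictMono (fun x : ℝ => μ + σ * x *
      (Real.exp (x * Real.log u) / A + Real.exp (-x * Real.log v) / A + 1)) := by
  subst hA
  simp only [neg_mul_comm]
  refine ⟨fun hu' hv' => ⟨⟨by fun_prop, by fun_prop, fun x _ =>
    ⟨(hasDerivAt_exp_mul_div _ _ x).differentiableAt,
      (hasDerivAt_exp_mul_div _ _ x).differentiableAt⟩⟩, ⟨fun x y hxy => ?_, fun x y hxy => ?_⟩,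
    ⟨tendsto_exp_div_zero 4 (tendsto_id.atBot_mul_const (log_pos hu')),
      tendsto_exp_div_zero 4 (tendsto_id.atTop_mul_const_of_neg (neg_lt_zero.2 (log_pos hv')))⟩,
    fun x _ => ⟨?_, ?_⟩⟩, strictMono_add_mul_exp_div_four _ _ μ hσ⟩
  · have := mul_le_mul_of_nonneg_right hxy (log_nonneg hu)
    dsimp only
    gcongr
  · have := mul_le_mul_of_nonpos_right hxy (neg_nonpos.2 (log_nonneg hv))
    dsimp only
    gcongr
  · rw [(hasDerivAt_exp_mul_div _ _ x).deriv]
    exact neg_half_lt_exp_div_four_add _ x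
  · rw [(hasDerivAt_exp_mul_div _ _ x).deriv]
    exact neg_half_lt_exp_div_four_add _ x
end

section
/- Fix A = 4, u > 1, v ≥ 1, μ ∈ ℝ, σ > 0, and let Z be a standard Gaussian random variable. Define Y = μ + σ·Z·(u^Z/A + v^{−Z}/A + 1). Then the distribution of Y has a heavier right tail than the Gaussian distribution: for every μ' ∈ ℝ and σ' > 0, P(Y > x) / (1 − Φ((x − μ')/σ')) → +∞ as x → +∞, where Φ is the standard normal cumulative distribution function. -/
open Filter Real Set MeasureTheory ProbabilityTheory

/-- Chernoff bound for the standard normal distribution. -/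
lemma gaussianReal_real_Ioi_le {t : ℝ} (ht : 0 ≤ t) :
    (gaussianReal 0 1).real (Ioi t) ≤ exp (-(t ^ 2 / 2)) := by
  have h := measure_ge_le_exp_mul_mgf (X := id) (μ := gaussianReal 0 1) t ht
    (integrable_exp_mul_gaussianReal t)
  rw [mgf_id_gaussianReal, ← exp_add] at h
  calc (gaussianReal 0 1).real (Ioi t) ≤ (gaussianReal 0 1).real {x | t ≤ id x} :=
        measureReal_mono (Ioi_subset_Ici_self : Ioi t ⊆ Ici t)
    _ ≤ _ := h
    _ = _ := by congr 1; simp; ring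

/-- The upper tail at `s` is at least the value of the standard normal density at `s + 1`. -/
lemma exp_div_sqrt_le_gaussianReal_real_Ioi {s : ℝ} (hs : 0 ≤ s) :
    exp (-((s + 1) ^ 2 / 2)) / √(2 * π) ≤ (gaussianReal 0 1).real (Ioi s) := by
  rw [Measure.real, ← ENNReal.ofReal_le_iff_le_toReal (measure_ne_top _ _),
    gaussianReal_apply 0 one_ne_zero]
  calc ENNReal.ofReal (exp (-((s + 1) ^ 2 / 2)) / √(2 * π))
      = ∫⁻ _ in Ioc s (s + 1), ENNReal.ofReal (exp (-((s + 1) ^ 2 / 2)) / √(2 * π)) := by simp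
    _ ≤ ∫⁻ x in Ioc s (s + 1), gaussianPDF 0 1 x := by
        refine setLIntegral_mono (measurable_gaussianPDF 0 1) fun x hx => ?_
        refine ENNReal.ofReal_le_ofReal ?_
        have hsq : x ^ 2 ≤ (s + 1) ^ 2 := pow_le_pow_left₀ (hs.trans hx.1.le) hx.2 2
        simp only [gaussianPDFReal, NNReal.coe_one, mul_one, sub_zero]
        rw [div_eq_inv_mul]
        gcongr
        linarith
    _ ≤ ∫⁻ x in Ioi s, gaussianPDF 0 1 x := lintegral_mono_set Ioc_subset_Ioi_self

/-- The standard normal tail at `s` dominates the tail at `4 * s`. -/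
lemma tendsto_gaussianReal_tail_ratio :
    Tendsto (fun s : ℝ => (gaussianReal 0 1).real (Ioi s) / (gaussianReal 0 1).real (Ioi (4 * s)))
      atTop atTop := by
  have hlim : Tendsto (fun s : ℝ => exp s / √(2 * π)) atTop atTop :=
    tendsto_exp_atTop.atTop_div_const (by positivity)
  refine tendsto_atTop_mono' _ ?_ hlim
  filter_upwards [eventually_ge_atTop 1] with s hs
  have hpos : 0 < (gaussianReal 0 1).real (Ioi (4 * s)) :=
    lt_of_lt_of_le (by positivity) (exp_div_sqrt_le_gaussianReal_real_Ioi (by linarith))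
  rw [le_div_iff₀ hpos]
  calc exp s / √(2 * π) * (gaussianReal 0 1).real (Ioi (4 * s))
      ≤ exp s / √(2 * π) * exp (-((4 * s) ^ 2 / 2)) := by
        gcongr
        exact gaussianReal_real_Ioi_le (by linarith)
    _ = exp (s + -((4 * s) ^ 2 / 2)) / √(2 * π) := by rw [exp_add]; ring
    _ ≤ exp (-((s + 1) ^ 2 / 2)) / √(2 * π) := by
        gcongr
        nlinarith
    _ ≤ _ := exp_div_sqrt_le_gaussianReal_real_Ioi (by linarith)

/-- With `A = 4`, `u > 1`, `v ≥ 1`, the PGML variable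
`Y = μ + σ·Z·(u^Z/A + v^{−Z}/A + 1)` built from a standard Gaussian `Z` has a heavier
right tail than any Gaussian: `P(Y > x)/(1 − Φ((x−μ')/σ')) → +∞` as `x → +∞`. -/
theorem pgml_heavier_right_tail
    {Ω : Type*} [MeasurableSpace Ω] (P : Measure Ω) [IsProbabilityMeasure P]
    (Z : Ω → ℝ) (hZ : Measurable Z)
    (hZgauss : Measure.map Z P = gaussianReal 0 1)
    (A u v μ σ : ℝ) (hA : A = 4) (hu : 1 < u) (hv : 1 ≤ v) (hσ : 0 < σ) :
    ∀ μ' σ' : ℝ, 0 < σ' →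
      Tendsto (fun x : ℝ =>
          (P {ω | x < μ + σ * Z ω * (Real.exp (Z ω * Real.log u) / A +
            Real.exp (-(Z ω) * Real.log v) / A + 1)}).toReal /
          (1 - ((gaussianReal 0 1) (Set.Iic ((x - μ') / σ'))).toReal))
        atTop atTop := by
  intro μ' σ' hσ'
  subst hA
  have hlog : 0 < log u := log_pos hu
  have hs : Tendsto (fun x : ℝ => (x - μ') / σ' / 4) atTop atTop :=
    ((tendsto_atTop_add_const_right _ (-μ') tendsto_id).atTop_div_const hσ').atTop_div_const
      (by norm_num)
  have hexp : Tendsto (fun s : ℝ => exp (s * log u)) atTop atTop :=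
    tendsto_exp_atTop.comp (tendsto_id.atTop_mul_const hlog)
  have hY : ∀ᶠ s : ℝ in atTop, ∀ z, s < z →
      μ' + 4 * σ' * s < μ + σ * z * (exp (z * log u) / 4 + exp (-z * log v) / 4 + 1) := by
    filter_upwards [eventually_ge_atTop 1,
      hexp.eventually_ge_atTop (4 * ((|μ' - μ| + 4 * σ') / σ))] with s hs1 hse z hz
    have hE : (|μ' - μ| + 4 * σ') / σ ≤ exp (z * log u) / 4 := by
      have : exp (s * log u) ≤ exp (z * log u) := by gcongr
      linarith
    have hE' : |μ' - μ| + 4 * σ' ≤ σ * (exp (z * log u) / 4) := by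
      rwa [div_le_iff₀' hσ] at hE
    have hz0 : 0 < z := by linarith
    have hmul := mul_le_mul_of_nonneg_right hE' hz0.le
    have hrest : 0 < σ * z * (exp (-z * log v) / 4 + 1) := by positivity
    have habs : μ' - μ ≤ |μ' - μ| * z :=
      (le_abs_self _).trans (le_mul_of_one_le_right (abs_nonneg _) (by linarith))
    have hσs : σ' * s < σ' * z := mul_lt_mul_of_pos_left hz hσ'
    linarith
  refine tendsto_atTop_mono' _ ?_ (tendsto_gaussianReal_tail_ratio.comp hs)
  filter_upwards [hs.eventually hY] with x hx
  have hden : 1 - ((gaussianReal 0 1) (Iic ((x - μ') / σ'))).toReal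
      = (gaussianReal 0 1).real (Ioi (4 * ((x - μ') / σ' / 4))) := by
    rw [mul_div_cancel₀ _ four_ne_zero, ← compl_Iic, probReal_compl_eq_one_sub measurableSet_Iic]
    rfl
  rw [hden, Function.comp_apply]
  gcongr
  rw [← hZgauss, map_measureReal_apply hZ measurableSet_Ioi]
  refine measureReal_mono fun ω hω => ?_
  have h := hx (Z ω) hω
  have hxs : μ' + 4 * σ' * ((x - μ') / σ' / 4) = x := by field_simp; ring
  rwa [hxs] at h
end

section
/- Fix A = 4, u ≥ 1, v > 1, μ ∈ ℝ, σ > 0, and let Z be a standard Gaussian random variable. Define Y = μ + σ·Z·(u^Z/A + v^{−Z}/A + 1). Then the distribution of Y has a heavier left tail than the Gaussian distribution: for every μ' ∈ ℝ and σ' > 0, P(Y < −x) / Φ((−x − μ')/σ') → +∞ as x → +∞, where Φ is the standard normal cumulative distribution function. -/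
open Filter Real Set MeasureTheory ProbabilityTheory

/-- Chernoff bound for the left tail of the standard normal distribution. -/
lemma gaussianReal_real_Iic_neg_le {y : ℝ} (hy : 0 ≤ y) :
    (gaussianReal 0 1).real (Iic (-y)) ≤ exp (-(y ^ 2 / 2)) := by
  have h := measure_le_le_exp_mul_mgf (μ := gaussianReal 0 1) (X := id) (t := -y) (-y)
    (by linarith) (integrable_exp_mul_gaussianReal (-y))
  rw [mgf_id_gaussianReal, ← Real.exp_add] at h
  refine h.trans_eq (congrArg exp ?_)
  push_cast
  ring

/-- A lower bound for the left tail of the standard normal distribution, from the density on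
an interval of length one. -/
lemma le_gaussianReal_real_Iio_neg {a : ℝ} (ha : 0 ≤ a) :
    (√(2 * π))⁻¹ * exp (-((a + 1) ^ 2 / 2)) ≤ (gaussianReal 0 1).real (Iio (-a)) := by
  rw [measureReal_def, ← ENNReal.ofReal_le_iff_le_toReal (measure_ne_top _ _),
    gaussianReal_apply 0 one_ne_zero]
  calc ENNReal.ofReal ((√(2 * π))⁻¹ * exp (-((a + 1) ^ 2 / 2)))
      = ∫⁻ _ in Ico (-(a + 1)) (-a), ENNReal.ofReal ((√(2 * π))⁻¹ * exp (-((a + 1) ^ 2 / 2))) := by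
        simp
    _ ≤ ∫⁻ x in Ico (-(a + 1)) (-a), gaussianPDF 0 1 x := by
        refine setLIntegral_mono (measurable_gaussianPDF 0 1) fun x hx => ?_
        refine ENNReal.ofReal_le_ofReal ?_
        simp only [gaussianPDFReal, NNReal.coe_one, mul_one, sub_zero]
        gcongr
        have : x ^ 2 ≤ (a + 1) ^ 2 := sq_le_sq' hx.1 (by linarith [hx.2])
        linarith
    _ ≤ ∫⁻ x in Iio (-a), gaussianPDF 0 1 x := lintegral_mono_set fun x hx => hx.2

/-- For every `ε > 0`, the transform `z ↦ μ + σ z (p + exp (-z c) / A + 1)`, `p ≥ 0`, eventually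
sends all `z < -ε x` below `-x`. -/
lemma eventually_tail_transform_lt {A c σ ε : ℝ} (μ : ℝ) (hA : 0 < A) (hc : 0 < c) (hσ : 0 < σ)
    (hε : 0 < ε) :
    ∀ᶠ x : ℝ in atTop, ∀ z p : ℝ, 0 ≤ p → z < -(ε * x) →
      μ + σ * z * (p + exp (-z * c) / A + 1) < -x := by
  have hk : 0 < σ * c * ε ^ 2 / A := by positivity
  filter_upwards [eventually_gt_atTop 0, eventually_gt_atTop |μ|,
    eventually_gt_atTop (2 / (σ * c * ε ^ 2 / A))] with x hx hμ hx2 z p hp hz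
  rw [div_lt_iff₀ hk] at hx2
  have hεx : 0 < ε * x := by positivity
  have hexp : c * (ε * x) ≤ exp (-z * c) := by
    have := add_one_le_exp (-z * c)
    nlinarith
  have hfac : c * (ε * x) / A ≤ p + exp (-z * c) / A + 1 := by
    have : c * (ε * x) / A ≤ exp (-z * c) / A := by gcongr
    linarith
  have hprod : σ * (ε * x) * (c * (ε * x) / A) ≤ σ * (-z) * (p + exp (-z * c) / A + 1) := by
    have : ε * x ≤ -z := by linarith
    gcongr
    exact mul_nonneg hσ.le (hεx.le.trans this)
  have hsq : σ * (ε * x) * (c * (ε * x) / A) = x * (σ * c * ε ^ 2 / A) * x := by ring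
  have hμ' := le_abs_self μ
  nlinarith

/-- With `A = 4`, `u ≥ 1`, `v > 1`, the PGML variable
`Y = μ + σ·Z·(u^Z/A + v^{−Z}/A + 1)` built from a standard Gaussian `Z` has a heavier
left tail than any Gaussian: `P(Y < −x)/Φ((−x−μ')/σ') → +∞` as `x → +∞`. -/
theorem pgml_heavier_left_tail
    {Ω : Type*} [MeasurableSpace Ω] (P : Measure Ω) [IsProbabilityMeasure P]
    (Z : Ω → ℝ) (hZ : Measurable Z)
    (hZgauss : Measure.map Z P = gaussianReal 0 1)
    (A u v μ σ : ℝ) (hA : A = 4) (hu : 1 ≤ u) (hv : 1 < v) (hσ : 0 < σ) :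
    ∀ μ' σ' : ℝ, 0 < σ' →
      Tendsto (fun x : ℝ =>
          (P {ω | μ + σ * Z ω * (Real.exp (Z ω * Real.log u) / A +
            Real.exp (-(Z ω) * Real.log v) / A + 1) < -x}).toReal /
          ((gaussianReal 0 1) (Set.Iic ((-x - μ') / σ'))).toReal)
        atTop atTop := by
  intro μ' σ' hσ'
  have hA0 : 0 < A := by rw [hA]; norm_num
  set ε : ℝ := (2 * σ')⁻¹ with hε_def
  have hε : 0 < ε := by positivity
  have hlim : Tendsto (fun x : ℝ => (√(2 * π))⁻¹ *
      exp (((x + μ') / σ') ^ 2 / 2 - (ε * x + 1) ^ 2 / 2)) atTop atTop := by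
    refine (tendsto_exp_atTop.comp ?_).const_mul_atTop (by positivity)
    have hfactor : (fun x : ℝ => ((x + μ') / σ') ^ 2 / 2 - (ε * x + 1) ^ 2 / 2) =
        fun x => (ε * x + (μ' / σ' - 1)) * (3 * ε * x + (μ' / σ' + 1)) / 2 := by
      funext x
      rw [hε_def]
      field_simp
      ring
    rw [hfactor]
    refine Tendsto.atTop_div_const two_pos (Tendsto.atTop_mul_atTop₀ ?_ ?_)
    · exact tendsto_atTop_add_const_right _ _ (tendsto_id.const_mul_atTop hε)
    · exact tendsto_atTop_add_const_right _ _ (tendsto_id.const_mul_atTop (by positivity))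
  refine tendsto_atTop_mono' _ ?_ hlim
  filter_upwards [eventually_tail_transform_lt μ hA0 (Real.log_pos hv) hσ hε,
    eventually_ge_atTop 0, eventually_ge_atTop (-μ')] with x hx hx0 hxμ
  have hnum : (√(2 * π))⁻¹ * exp (-((ε * x + 1) ^ 2 / 2)) ≤
      (P {ω | μ + σ * Z ω * (Real.exp (Z ω * Real.log u) / A +
            Real.exp (-(Z ω) * Real.log v) / A + 1) < -x}).toReal := by
    refine (le_gaussianReal_real_Iio_neg (by positivity)).trans ?_
    rw [← hZgauss, map_measureReal_apply hZ measurableSet_Iio]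
    exact measureReal_mono fun ω hω => hx (Z ω) _ (by positivity) hω
  have hy : 0 ≤ (x + μ') / σ' := div_nonneg (by linarith) hσ'.le
  have hneg : (-x - μ') / σ' = -((x + μ') / σ') := by ring
  rw [hneg]
  have hpos : 0 < ((gaussianReal 0 1) (Iic (-((x + μ') / σ')))).toReal :=
    lt_of_lt_of_le (by positivity) ((le_gaussianReal_real_Iio_neg hy).trans
      (measureReal_mono Iio_subset_Iic_self))
  rw [le_div_iff₀ hpos]
  calc _ ≤ (√(2 * π))⁻¹ * exp (((x + μ') / σ') ^ 2 / 2 - (ε * x + 1) ^ 2 / 2) *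
        exp (-(((x + μ') / σ') ^ 2 / 2)) := by
        gcongr
        exact gaussianReal_real_Iic_neg_le hy
    _ = (√(2 * π))⁻¹ * exp (-((ε * x + 1) ^ 2 / 2)) := by
        rw [mul_assoc, ← Real.exp_add]
        ring_nf
    _ ≤ _ := hnum
end
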